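/- arXiv:2106.00498 — 5 statements merged into one kernel-verified Lean document; each statement's English description precedes it below -/
import Mathlib

section
/- Fix Δt > 0, γ ≥ 1, β ∈ [0,1), x ∈ ℝ, let φ : ℝ → ℝ be twice continuously differentiable, and let ρⁿ, qⁿ : ℝ → ℝ be twice continuously differentiable with ρⁿ > 0. For ε ∈ (0,1], let ρ^{n+1}(ε) denote the value at x of the reformulated mass update ρⁿ − (ε^{1+β}Δt/(ε^{1+β}+Δt)) ∂_x qⁿ + (ε^{1+β}Δt²/(ε^{1+β}+Δt)) ∂_{xx}((qⁿ)²/ρⁿ) + (ε^{1−β}Δt²/(ε^{1+β}+Δt)) ∂_{xx}((ρⁿ)^γ) − (Δt²/(ε^{1+β}+Δt)) ∂_x(ρⁿ ∂_x φ). Then lim_{ε→0⁺} ρ^{n+1}(ε) = ρⁿ(x) − Δt ∂_x(ρⁿ ∂_x φ)(x), i.e., the scheme converges to a consistent explicit time discretisation of the transport equation ∂_t ρ + ∂_x(ρ ∂_x φ) = 0. -/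
open Real Filter Topology

/-- A positive real power tends to `0` at `0` from the right. -/
theorem tendsto_rpow_nhdsGT_zero {s : ℝ} (hs : 0 < s) :
    Tendsto (fun ε : ℝ => ε ^ s) (𝓝[>] 0) (𝓝 0) := by
  have h := (Real.continuousAt_rpow_const 0 s (Or.inr hs.le)).tendsto
  rw [Real.zero_rpow hs.ne'] at h
  exact h.mono_left nhdsWithin_le_nhds

/-- AP property, hyperbolic scaling β ∈ [0,1): as ε → 0⁺ the reformulated mass update
converges to an explicit time discretisation of the transport equation
`∂_t ρ + ∂_x(ρ ∂_x φ) = 0`. -/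
theorem mass_update_hyperbolic_limit
    (Δt γ β x : ℝ) (hΔt : 0 < Δt) (hγ : 1 ≤ γ) (hβ : β ∈ Set.Ico (0 : ℝ) 1)
    (φ ρ q : ℝ → ℝ) (hφ : ContDiff ℝ 2 φ) (hρ : ContDiff ℝ 2 ρ) (hq : ContDiff ℝ 2 q)
    (hρpos : ∀ y : ℝ, 0 < ρ y) :
    Tendsto (fun ε : ℝ =>
        ρ x - (ε ^ (1 + β) * Δt / (ε ^ (1 + β) + Δt)) * deriv q x
          + (ε ^ (1 + β) * Δt ^ 2 / (ε ^ (1 + β) + Δt)) *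
              deriv (deriv (fun y => (q y) ^ 2 / ρ y)) x
          + (ε ^ (1 - β) * Δt ^ 2 / (ε ^ (1 + β) + Δt)) *
              deriv (deriv (fun y => ρ y ^ γ)) x
          - (Δt ^ 2 / (ε ^ (1 + β) + Δt)) * deriv (fun y => ρ y * deriv φ y) x)
      (nhdsWithin 0 (Set.Ioi 0))
      (nhds (ρ x - Δt * deriv (fun y => ρ y * deriv φ y) x)) := by
  have h₁ : Tendsto (fun ε : ℝ => ε ^ (1 + β)) (𝓝[>] 0) (𝓝 0) :=
    tendsto_rpow_nhdsGT_zero (by linarith [hβ.1])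
  have h₂ : Tendsto (fun ε : ℝ => ε ^ (1 - β)) (𝓝[>] 0) (𝓝 0) :=
    tendsto_rpow_nhdsGT_zero (by linarith [hβ.2])
  have hden := h₁.add_const Δt
  have hne : (0 : ℝ) + Δt ≠ 0 := by simpa using hΔt.ne'
  have hlim := (((tendsto_const_nhds (x := ρ x)).sub
    (((h₁.mul_const Δt).div hden hne).mul_const (deriv q x))).add
    (((h₁.mul_const (Δt ^ 2)).div hden hne).mul_const
      (deriv (deriv (fun y => (q y) ^ 2 / ρ y)) x))).add
    (((h₂.mul_const (Δt ^ 2)).div hden hne).mul_const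
      (deriv (deriv (fun y => ρ y ^ γ)) x)) |>.sub
    (((tendsto_const_nhds (x := Δt ^ 2)).div hden hne).mul_const
      (deriv (fun y => ρ y * deriv φ y) x))
  have hsq : Δt ^ 2 / Δt = Δt := by field_simp
  simp only [zero_add, zero_mul, zero_div, sub_zero, add_zero, hsq] at hlim
  exact hlim
end

section
/- Fix Δt > 0, γ ≥ 1, x ∈ ℝ, let φ : ℝ → ℝ be continuously differentiable, and let ρⁿ, qⁿ : ℝ → ℝ be continuously differentiable with ρⁿ > 0. For β = 1 and ε ∈ (0,1], let q^{n+1}(ε) denote the value at x of the reformulated momentum update qⁿ − (ε²Δt/(ε²+Δt)) ∂_x((qⁿ)²/ρⁿ) − (Δt/(ε²+Δt)) ∂_x((ρⁿ)^γ) − (Δt/(ε²+Δt))(qⁿ − ρⁿ ∂_x φ). Then lim_{ε→0⁺} q^{n+1}(ε) = ρⁿ(x) ∂_x φ(x) − ∂_x((ρⁿ)^γ)(x), i.e., the updated momentum converges to the Darcy-type momentum of the parabolic limit system. -/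
open Real Filter Topology

/-- AP property of the momentum update, parabolic scaling β = 1: as ε → 0⁺ the
reformulated momentum update converges to the Darcy-type momentum
`ρ ∂_x φ - ∂_x(ρ^γ)` of the parabolic limit system. -/
theorem momentum_update_parabolic_limit
    (Δt γ x : ℝ) (hΔt : 0 < Δt) (hγ : 1 ≤ γ)
    (φ ρ q : ℝ → ℝ) (hφ : ContDiff ℝ 1 φ) (hρ : ContDiff ℝ 1 ρ) (hq : ContDiff ℝ 1 q)
    (hρpos : ∀ y : ℝ, 0 < ρ y) :
    Tendsto (fun ε : ℝ =>
        q x - (ε ^ 2 * Δt / (ε ^ 2 + Δt)) * deriv (fun y => (q y) ^ 2 / ρ y) x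
          - (Δt / (ε ^ 2 + Δt)) * deriv (fun y => ρ y ^ γ) x
          - (Δt / (ε ^ 2 + Δt)) * (q x - ρ x * deriv φ x))
      (nhdsWithin 0 (Set.Ioi 0))
      (nhds (ρ x * deriv φ x - deriv (fun y => ρ y ^ γ) x)) := by
  have hne : (0 : ℝ) ^ 2 + Δt ≠ 0 := by positivity
  have hden : Tendsto (fun ε : ℝ => ε ^ 2 + Δt) (𝓝[>] 0) (𝓝 (0 ^ 2 + Δt)) :=
    ((continuous_id.pow 2).add continuous_const).continuousWithinAt
  have hsq : Tendsto (fun ε : ℝ => ε ^ 2 * Δt) (𝓝[>] 0) (𝓝 (0 ^ 2 * Δt)) :=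
    ((continuous_id.pow 2).mul continuous_const).continuousWithinAt
  have hflux := hsq.div hden hne
  have hrelax := (tendsto_const_nhds (x := Δt)).div hden hne
  have hlim := (((tendsto_const_nhds (x := q x)).sub
    (hflux.mul_const (deriv (fun y => (q y) ^ 2 / ρ y) x))).sub
    (hrelax.mul_const (deriv (fun y => ρ y ^ γ) x))).sub
    (hrelax.mul_const (q x - ρ x * deriv φ x))
  have hval : q x - 0 ^ 2 * Δt / (0 ^ 2 + Δt) * deriv (fun y => (q y) ^ 2 / ρ y) x
      - Δt / (0 ^ 2 + Δt) * deriv (fun y => ρ y ^ γ) x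
      - Δt / (0 ^ 2 + Δt) * (q x - ρ x * deriv φ x)
      = ρ x * deriv φ x - deriv (fun y => ρ y ^ γ) x := by
    have hone : Δt / (0 ^ 2 + Δt) = 1 := by simp [hΔt.ne']
    rw [hone]
    ring
  rw [hval] at hlim
  exact hlim
end

section
/- Let ε ∈ (0,1], β ∈ [0,1], γ ≥ 1, x ∈ ℝ, and let φ : ℝ → ℝ be continuously differentiable. For each Δx > 0 let ρ_i(Δx), ρ_{i+1}(Δx) > 0 with ρ_i(Δx) → ρ and ρ_{i+1}(Δx) → ρ as Δx → 0⁺, where ρ > 0, and set φ_i = φ(x), φ_{i+1} = φ(x + Δx), ρ̄ = (ρ_i(Δx) + ρ_{i+1}(Δx))/2, m = min(φ_i, φ_{i+1}). Define the P-reconstructed interface densities ρ⁻(Δx), ρ⁺(Δx) ≥ 0 by ε^{1−β}(ρ⁻)^γ = max(0, ε^{1−β} ρ_i^γ + ρ̄(m − φ_i)) and ε^{1−β}(ρ⁺)^γ = max(0, ε^{1−β} ρ_{i+1}^γ + ρ̄(m − φ_{i+1})). Then lim_{Δx→0⁺} ((ρ⁻(Δx))^γ − ρ_i(Δx)^γ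 + ρ_{i+1}(Δx)^γ − (ρ⁺(Δx))^γ)/(ε^{2β} Δx) = ρ φ'(x)/ε^{1+β}; that is, the upwinded source discretisation is consistent with the source term ε^{−(1+β)} ρ ∂_x φ. -/
open Real Filter Topology

/-- If `a → l > 0` and `b → 0`, the truncation in `max 0 (a + b)` is eventually inactive. -/
theorem eventually_max_zero_add_eq {α : Type*} {f : Filter α} {a b : α → ℝ} {l : ℝ}
    (hl : 0 < l) (ha : Tendsto a f (𝓝 l)) (hb : Tendsto b f (𝓝 0)) :
    ∀ᶠ t in f, max 0 (a t + b t) = a t + b t := by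
  have h : Tendsto (fun t => a t + b t) f (𝓝 l) := by simpa using ha.add hb
  filter_upwards [h.eventually_const_lt hl] with t ht
  exact max_eq_right ht.le

/-- Consistency of the upwinded source discretisation: as Δx → 0⁺,
`((ρ⁻)^γ - ρ_i^γ + ρ_{i+1}^γ - (ρ⁺)^γ)/(ε^{2β} Δx) → ρ φ'(x)/ε^{1+β}`. -/
theorem upwinded_source_consistency
    (ε β γ x ρ : ℝ)
    (hε : ε ∈ Set.Ioc (0 : ℝ) 1) (hβ : β ∈ Set.Icc (0 : ℝ) 1) (hγ : 1 ≤ γ)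
    (hρ : 0 < ρ) (φ : ℝ → ℝ) (hφ : ContDiff ℝ 1 φ)
    (ρi ρj ρm ρp : ℝ → ℝ)
    (hρipos : ∀ dx : ℝ, 0 < dx → 0 < ρi dx)
    (hρjpos : ∀ dx : ℝ, 0 < dx → 0 < ρj dx)
    (hρilim : Tendsto ρi (nhdsWithin 0 (Set.Ioi 0)) (nhds ρ))
    (hρjlim : Tendsto ρj (nhdsWithin 0 (Set.Ioi 0)) (nhds ρ))
    (hρm : ∀ dx : ℝ, 0 ≤ ρm dx) (hρp : ∀ dx : ℝ, 0 ≤ ρp dx)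
    (hdefm : ∀ dx : ℝ, ε ^ (1 - β) * (ρm dx) ^ γ
      = max 0 (ε ^ (1 - β) * (ρi dx) ^ γ
          + ((ρi dx + ρj dx) / 2) * (min (φ x) (φ (x + dx)) - φ x)))
    (hdefp : ∀ dx : ℝ, ε ^ (1 - β) * (ρp dx) ^ γ
      = max 0 (ε ^ (1 - β) * (ρj dx) ^ γ
          + ((ρi dx + ρj dx) / 2) * (min (φ x) (φ (x + dx)) - φ (x + dx)))) :
    Tendsto (fun dx : ℝ =>
        ((ρm dx) ^ γ - (ρi dx) ^ γ + (ρj dx) ^ γ - (ρp dx) ^ γ) / (ε ^ (2 * β) * dx))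
      (nhdsWithin 0 (Set.Ioi 0))
      (nhds (ρ * deriv φ x / ε ^ (1 + β))) := by
  have hε0 : 0 < ε := hε.1
  have hE : 0 < ε ^ (1 - β) := rpow_pos_of_pos hε0 _
  have hB : 0 < ε ^ (2 * β) := rpow_pos_of_pos hε0 _
  have hEB : ε ^ (1 + β) = ε ^ (1 - β) * ε ^ (2 * β) := by
    rw [← rpow_add hε0]
    ring_nf
  have hmean : Tendsto (fun dx => (ρi dx + ρj dx) / 2) (𝓝[>] 0) (𝓝 ρ) := by
    simpa using (hρilim.add hρjlim).div_const 2
  have hshift : Tendsto (fun dx => φ (x + dx)) (𝓝[>] 0) (𝓝 (φ x)) := by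
    have h : Continuous fun dx => φ (x + dx) := hφ.continuous.comp (continuous_const_add x)
    simpa using (h.tendsto 0).mono_left nhdsWithin_le_nhds
  have hmin : Tendsto (fun dx => min (φ x) (φ (x + dx))) (𝓝[>] 0) (𝓝 (φ x)) := by
    simpa using (tendsto_const_nhds (x := φ x)).min hshift
  have hpow : ∀ {r : ℝ → ℝ}, Tendsto r (𝓝[>] 0) (𝓝 ρ) →
      Tendsto (fun dx => ε ^ (1 - β) * r dx ^ γ) (𝓝[>] 0) (𝓝 (ε ^ (1 - β) * ρ ^ γ)) :=
    fun hr => (hr.rpow_const (Or.inl hρ.ne')).const_mul _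
  have hpos : 0 < ε ^ (1 - β) * ρ ^ γ := mul_pos hE (rpow_pos_of_pos hρ γ)
  have hm := eventually_max_zero_add_eq hpos (hpow hρilim)
    (b := fun dx => (ρi dx + ρj dx) / 2 * (min (φ x) (φ (x + dx)) - φ x))
    (by simpa using hmean.mul (hmin.sub_const (φ x)))
  have hp := eventually_max_zero_add_eq hpos (hpow hρjlim)
    (b := fun dx => (ρi dx + ρj dx) / 2 * (min (φ x) (φ (x + dx)) - φ (x + dx)))
    (by simpa using hmean.mul (hmin.sub hshift))
  have hslope : Tendsto (fun dx => dx⁻¹ * (φ (x + dx) - φ x)) (𝓝[>] 0) (𝓝 (deriv φ x)) := by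
    simpa using
      ((hφ.differentiable one_ne_zero).differentiableAt (x := x)).hasDerivAt.tendsto_slope_zero_right
  refine ((hmean.mul hslope).div_const (ε ^ (1 + β))).congr' ?_
  filter_upwards [hm, hp, self_mem_nhdsWithin] with dx hm hp (hdx : 0 < dx)
  have h₁ := (hdefm dx).trans hm
  have h₂ := (hdefp dx).trans hp
  have key : ε ^ (1 - β) * (ρm dx ^ γ - ρi dx ^ γ + ρj dx ^ γ - ρp dx ^ γ)
      = (ρi dx + ρj dx) / 2 * (φ (x + dx) - φ x) := by
    linear_combination h₁ - h₂
  rw [hEB, div_eq_div_iff (mul_pos hE hB).ne' (mul_pos hB hdx).ne']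
  calc (ρi dx + ρj dx) / 2 * (dx⁻¹ * (φ (x + dx) - φ x)) * (ε ^ (2 * β) * dx)
      = (ρi dx + ρj dx) / 2 * (φ (x + dx) - φ x) * ε ^ (2 * β) := by
        field_simp
    _ = _ := by
        rw [← key]
        ring
end

section
/- Let ε ∈ (0,1], β ∈ [0,1], γ ≥ 1, Δt > 0, Δx > 0. Let 𝓕 = (𝓕^ρ, 𝓕^q) : ((0,∞)×ℝ)² → ℝ² be any numerical flux that is consistent with the Euler flux, i.e., 𝓕((ρ,q),(ρ,q)) = (q, q²/ρ + ε^{−2β} ρ^γ) for all ρ > 0, q ∈ ℝ. Let (ρ_i, q_i, φ_i)_{i∈ℤ} with ρ_i > 0 be a discrete hydrostatic steady state: q_i = 0 and ε^{1−β}(ρ_{i+1}^γ − ρ_i^γ) = ρ̄_{i+1/2}(φ_{i+1} − φ_i) for all i, where ρ̄_{i+1/2} = (ρ_i+ρ_{i+1})/2. For each i define the P-reconstructed interface states U^∓_{i+1/2} = (ρ^∓_{i+1/2}, ρ^∓_{i+1/2} u_{i resp. i+1}) with u_j = q_j/ρ_j and ε^{1−β}(ρ⁻_{i+1/2})^γ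 = max(0, ε^{1−β}ρ_i^γ + ρ̄_{i+1/2}(m_{i+1/2} − φ_i)), ε^{1−β}(ρ⁺_{i+1/2})^γ = max(0, ε^{1−β}ρ_{i+1}^γ + ρ̄_{i+1/2}(m_{i+1/2} − φ_{i+1})), m_{i+1/2} = min(φ_i, φ_{i+1}). Define the updates ρ^{n+1}_i = ρ_i − a₁(𝓕^ρ(U⁻_{i+1/2},U⁺_{i+1/2}) − 𝓕^ρ(U⁻_{i−1/2},U⁺_{i−1/2}))/Δx + a₂(q_{i+1}²/ρ_{i+1} − 2q_i²/ρ_i + q_{i−1}²/ρ_{i−1})/Δx² + a₃(ρ_{i+1}^γ − 2ρ_i^γ + ρ_{i−1}^γ)/Δx² − a₄(ρ̄_{i+1/2}(φ_{i+1}−φ_i) − ρ̄_{i−1/2}(φ_i−φ_{i−1}))/Δx², and q^{n+1}_i = q_i − a₁(𝓕^q(U⁻_{i+1/2},U⁺_{i+1/2}) − 𝓕^q(U⁻_{i−1/2},U⁺_{i−1/2}))/Δx − a₅ q_i + a₆((ρ⁻_{i+1/2})^γ − (ρ⁺_{i−1/2})^γ)/Δx, where a₁ = ε^{1+β}Δt/(ε^{1+β}+Δt),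 a₂ = ε^{1+β}Δt²/(ε^{1+β}+Δt), a₃ = ε^{1−β}Δt²/(ε^{1+β}+Δt), a₄ = Δt²/(ε^{1+β}+Δt), a₅ = Δt/(ε^{1+β}+Δt), a₆ = ε^{1−β}Δt/(ε^{1+β}+Δt). Then ρ^{n+1}_i = ρ_i and q^{n+1}_i = 0 for all i; i.e., the scheme is well-balanced for discrete hydrostatic steady states. -/
open Real Filter Topology

/-- At a discrete hydrostatic balance, the left and right P-reconstructed interface densities
coincide and are positive. Here `c` is the pressure scaling, `w` the interface weight, and
`m` the interface value of the potential. -/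
lemma reconstructed_densities_eq_and_pos {c γ a b w x y rm rp : ℝ} (hc : 0 < c) (hγ : 0 < γ)
    (ha : 0 < a) (hb : 0 < b) (hrm : 0 ≤ rm) (hrp : 0 ≤ rp)
    (hbal : c * (b ^ γ - a ^ γ) = w * (y - x))
    (hm : c * rm ^ γ = max 0 (c * a ^ γ + w * (min x y - x)))
    (hp : c * rp ^ γ = max 0 (c * b ^ γ + w * (min x y - y))) :
    rm = rp ∧ 0 < rm := by
  have hca : 0 < c * a ^ γ := by positivity
  have hcb : 0 < c * b ^ γ := by positivity
  have harg : c * b ^ γ + w * (min x y - y) = c * a ^ γ + w * (min x y - x) := by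
    linear_combination hbal
  have hpos : 0 < c * a ^ γ + w * (min x y - x) := by
    rcases le_total x y with h | h
    · rw [min_eq_left h]
      linarith
    · rw [min_eq_right h]
      linarith
  rw [harg, ← hm] at hp
  refine ⟨((Real.rpow_left_inj hrp hrm hγ.ne').1 (mul_left_cancel₀ hc.ne' hp)).symm, ?_⟩
  refine hrm.lt_of_ne' fun h => ?_
  rw [h, Real.zero_rpow hγ.ne', mul_zero, max_eq_right hpos.le] at hm
  exact hpos.ne hm

/-- Well-balancing of the fully-discrete scheme (Theorem 4.1 (ii)): for any
numerical flux consistent with the Euler flux, at a discrete hydrostatic steady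
state (zero momenta and the discrete hydrostatic relation), the full update
with hydrostatic P-reconstruction, upwinded sources and central parabolic terms
returns the same state: `ρ^{n+1}_i = ρ_i` and `q^{n+1}_i = 0`. -/
theorem fully_discrete_scheme_well_balanced
    (ε β γ Δt Δx : ℝ)
    (hε : ε ∈ Set.Ioc (0 : ℝ) 1) (hβ : β ∈ Set.Icc (0 : ℝ) 1) (hγ : 1 ≤ γ)
    (hΔt : 0 < Δt) (hΔx : 0 < Δx)
    (F : ℝ × ℝ → ℝ × ℝ → ℝ × ℝ)
    (hF : ∀ r p : ℝ, 0 < r → F (r, p) (r, p) = (p, p ^ 2 / r + ε ^ (-(2 * β)) * r ^ γ))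
    (ρ q φ ρm ρp : ℤ → ℝ)
    (hρpos : ∀ i : ℤ, 0 < ρ i)
    (hq : ∀ i : ℤ, q i = 0)
    (hhydro : ∀ i : ℤ, ε ^ (1 - β) * ((ρ (i + 1)) ^ γ - (ρ i) ^ γ)
      = ((ρ i + ρ (i + 1)) / 2) * (φ (i + 1) - φ i))
    (hρm0 : ∀ i : ℤ, 0 ≤ ρm i) (hρp0 : ∀ i : ℤ, 0 ≤ ρp i)
    (hρm : ∀ i : ℤ, ε ^ (1 - β) * (ρm i) ^ γ
      = max 0 (ε ^ (1 - β) * (ρ i) ^ γ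
          + ((ρ i + ρ (i + 1)) / 2) * (min (φ i) (φ (i + 1)) - φ i)))
    (hρp : ∀ i : ℤ, ε ^ (1 - β) * (ρp i) ^ γ
      = max 0 (ε ^ (1 - β) * (ρ (i + 1)) ^ γ
          + ((ρ i + ρ (i + 1)) / 2) * (min (φ i) (φ (i + 1)) - φ (i + 1)))) :
    ∀ i : ℤ,
      (ρ i
        - (ε ^ (1 + β) * Δt / (ε ^ (1 + β) + Δt)) *
            ((F (ρm i, ρm i * (q i / ρ i)) (ρp i, ρp i * (q (i + 1) / ρ (i + 1)))).1
              - (F (ρm (i - 1), ρm (i - 1) * (q (i - 1) / ρ (i - 1)))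
                  (ρp (i - 1), ρp (i - 1) * (q i / ρ i))).1) / Δx
        + (ε ^ (1 + β) * Δt ^ 2 / (ε ^ (1 + β) + Δt)) *
            ((q (i + 1)) ^ 2 / ρ (i + 1) - 2 * (q i) ^ 2 / ρ i
              + (q (i - 1)) ^ 2 / ρ (i - 1)) / Δx ^ 2
        + (ε ^ (1 - β) * Δt ^ 2 / (ε ^ (1 + β) + Δt)) *
            ((ρ (i + 1)) ^ γ - 2 * (ρ i) ^ γ + (ρ (i - 1)) ^ γ) / Δx ^ 2
        - (Δt ^ 2 / (ε ^ (1 + β) + Δt)) *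
            (((ρ i + ρ (i + 1)) / 2) * (φ (i + 1) - φ i)
              - ((ρ (i - 1) + ρ i) / 2) * (φ i - φ (i - 1))) / Δx ^ 2
        = ρ i) ∧
      (q i
        - (ε ^ (1 + β) * Δt / (ε ^ (1 + β) + Δt)) *
            ((F (ρm i, ρm i * (q i / ρ i)) (ρp i, ρp i * (q (i + 1) / ρ (i + 1)))).2
              - (F (ρm (i - 1), ρm (i - 1) * (q (i - 1) / ρ (i - 1)))
                  (ρp (i - 1), ρp (i - 1) * (q i / ρ i))).2) / Δx
        - (Δt / (ε ^ (1 + β) + Δt)) * q i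
        + (ε ^ (1 - β) * Δt / (ε ^ (1 + β) + Δt)) *
            ((ρm i) ^ γ - (ρp (i - 1)) ^ γ) / Δx
        = 0) := by
  have hε0 : 0 < ε := hε.1
  have hrec : ∀ i, ρm i = ρp i ∧ 0 < ρm i := fun i =>
    reconstructed_densities_eq_and_pos (Real.rpow_pos_of_pos hε0 _) (by linarith) (hρpos i)
      (hρpos (i + 1)) (hρm0 i) (hρp0 i) (hhydro i) (hρm i) (hρp i)
  have hflux : ∀ i, F (ρm i, 0) (ρm i, 0) = (0, ε ^ (-(2 * β)) * ρm i ^ γ) := fun i => by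
    rw [hF _ _ (hrec i).2]
    simp
  have hscale : ε ^ (1 + β) * ε ^ (-(2 * β)) = ε ^ (1 - β) := by
    rw [← Real.rpow_add hε0]
    ring_nf
  intro i
  have hbal := hhydro i
  have hbal' := hhydro (i - 1)
  rw [sub_add_cancel] at hbal'
  simp only [hq, zero_div, mul_zero, ← (hrec _).1, hflux]
  constructor
  · linear_combination (Δt ^ 2 / (ε ^ (1 + β) + Δt) / Δx ^ 2) * (hbal - hbal')
  · linear_combination (-(Δt / (ε ^ (1 + β) + Δt)) * (ρm i ^ γ - ρm (i - 1) ^ γ) / Δx) * hscale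
end

section
/- Let γ ≥ 1, Δt > 0, Δx > 0, β = 1, and fix grid values (ρ_j, q_j, φ_j) for j ∈ {i−1, i, i+1} and the neighbouring interface data needed below, with all ρ_j > 0 and all P-reconstructed interface densities positive. For β = 1 the P-reconstructed interface states U^∓_{i+1/2} (defined by (ρ⁻_{i+1/2})^γ = max(0, ρ_i^γ + ρ̄_{i+1/2}(m_{i+1/2} − φ_i)), (ρ⁺_{i+1/2})^γ = max(0, ρ_{i+1}^γ + ρ̄_{i+1/2}(m_{i+1/2} − φ_{i+1})), momenta ρ^∓ u_{i resp. i+1}) do not depend on ε. For ε ∈ (0,1], let 𝓕_ε be the Rusanov flux 𝓕_ε(U_L,U_R) = ½(F_ε(U_L)+F_ε(U_R)) − (a_ε/2)(U_R − U_L), with F_ε(ρ,q) = (q, q²/ρ + ε^{−2} ρ^γ) and a_ε = max(|u_L| + ε^{−1}√(γ ρ_L^{γ−1}), |u_R| + ε^{−1}√(γ ρ_R^{γ−1})), and let ρ^{n+1}_i(ε) = ρ_i − a₁(ε)(𝓕_ε^ρ(U⁻_{i+1/2},U⁺_{i+1/2}) − 𝓕_ε^ρ(U⁻_{i−1/2},U⁺_{i−1/2}))/Δx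 + a₂(ε)(q_{i+1}²/ρ_{i+1} − 2q_i²/ρ_i + q_{i−1}²/ρ_{i−1})/Δx² + a₃(ε)(ρ_{i+1}^γ − 2ρ_i^γ + ρ_{i−1}^γ)/Δx² − a₄(ε)(ρ̄_{i+1/2}(φ_{i+1}−φ_i) − ρ̄_{i−1/2}(φ_i−φ_{i−1}))/Δx², where a₁ = ε²Δt/(ε²+Δt), a₂ = ε²Δt²/(ε²+Δt), a₃ = Δt²/(ε²+Δt), a₄ = Δt²/(ε²+Δt). Then lim_{ε→0⁺} ρ^{n+1}_i(ε) = ρ_i + Δt(ρ_{i+1}^γ − 2ρ_i^γ + ρ_{i−1}^γ)/Δx² − Δt(ρ̄_{i+1/2}(φ_{i+1}−φ_i) − ρ̄_{i−1/2}(φ_i−φ_{i−1}))/Δx², which is an explicit finite difference discretisation of the porous medium equation ∂_t ρ + ∂_x(ρ ∂_x φ) = ∂_{xx}(ρ^γ). -/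
open Real Filter Topology

/-- The Rusanov numerical flux for the scaled Euler system with pressure `ρ^γ`:
`𝓕_ε(U_L,U_R) = ½(F_ε(U_L)+F_ε(U_R)) - (a_ε/2)(U_R - U_L)` with
`F_ε(ρ,q) = (q, q²/ρ + ε^{-2} ρ^γ)` and
`a_ε = max(|u_L| + ε^{-1}√(γ ρ_L^{γ-1}), |u_R| + ε^{-1}√(γ ρ_R^{γ-1}))`. -/
noncomputable def rusanovFlux (γ ε : ℝ) (UL UR : ℝ × ℝ) : ℝ × ℝ :=
  ((UL.2 + UR.2) / 2
      - max (|UL.2 / UL.1| + ε⁻¹ * Real.sqrt (γ * UL.1 ^ (γ - 1)))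
          (|UR.2 / UR.1| + ε⁻¹ * Real.sqrt (γ * UR.1 ^ (γ - 1))) / 2 * (UR.1 - UL.1),
    ((UL.2 ^ 2 / UL.1 + ε ^ ((-2 : ℝ)) * UL.1 ^ γ)
        + (UR.2 ^ 2 / UR.1 + ε ^ ((-2 : ℝ)) * UR.1 ^ γ)) / 2
      - max (|UL.2 / UL.1| + ε⁻¹ * Real.sqrt (γ * UL.1 ^ (γ - 1)))
          (|UR.2 / UR.1| + ε⁻¹ * Real.sqrt (γ * UR.1 ^ (γ - 1))) / 2 * (UR.2 - UL.2))

/-- The mass component of the Rusanov flux grows at most like `ε⁻¹` as `ε → 0⁺`. -/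
theorem tendsto_mul_rusanovFlux_fst (γ : ℝ) (UL UR : ℝ × ℝ) :
    Tendsto (fun ε : ℝ => ε * (rusanovFlux γ ε UL UR).1) (𝓝[>] 0)
      (𝓝 (-(max √(γ * UL.1 ^ (γ - 1)) √(γ * UR.1 ^ (γ - 1)) / 2 * (UR.1 - UL.1)))) := by
  have h : Tendsto (fun ε : ℝ => ε * ((UL.2 + UR.2) / 2)
      - max (ε * |UL.2 / UL.1| + √(γ * UL.1 ^ (γ - 1)))
          (ε * |UR.2 / UR.1| + √(γ * UR.1 ^ (γ - 1))) / 2 * (UR.1 - UL.1)) (𝓝[>] 0)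
      (𝓝 (-(max √(γ * UL.1 ^ (γ - 1)) √(γ * UR.1 ^ (γ - 1)) / 2 * (UR.1 - UL.1)))) := by
    refine tendsto_nhdsWithin_of_tendsto_nhds (Continuous.tendsto' (by fun_prop) _ _ ?_)
    simp
  refine h.congr' ?_
  filter_upwards [self_mem_nhdsWithin] with ε hε
  have hε : 0 < ε := hε
  have key (x y : ℝ) : ε * x + y = ε * (x + ε⁻¹ * y) := by field_simp
  rw [key, key, ← mul_max_of_nonneg _ _ hε.le, rusanovFlux]
  ring

/-- Multiplied by `ε²`, the mass component of the Rusanov flux vanishes as `ε → 0⁺`. -/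
theorem tendsto_sq_mul_rusanovFlux_fst (γ : ℝ) (UL UR : ℝ × ℝ) :
    Tendsto (fun ε : ℝ => ε ^ 2 * (rusanovFlux γ ε UL UR).1) (𝓝[>] 0) (𝓝 0) := by
  have hid : Tendsto (fun ε : ℝ => ε) (𝓝[>] 0) (𝓝 0) := nhdsWithin_le_nhds
  simpa [sq, mul_assoc] using hid.mul (tendsto_mul_rusanovFlux_fst γ UL UR)

/-- AP property of the fully-discrete mass update (Theorem 4.1 (iii), parabolic
case β = 1): with Rusanov fluxes at the hydrostatically P-reconstructed interface
states, as ε → 0⁺ the mass update converges to an explicit finite difference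
discretisation of the porous medium equation `∂_t ρ + ∂_x(ρ ∂_x φ) = ∂_{xx}(ρ^γ)`. -/
theorem fully_discrete_mass_update_parabolic_limit
    (γ Δt Δx : ℝ) (hγ : 1 ≤ γ) (hΔt : 0 < Δt) (hΔx : 0 < Δx)
    (ρim ρi ρip qim qi qip φim φi φip : ℝ)
    (hρim : 0 < ρim) (hρi : 0 < ρi) (hρip : 0 < ρip)
    (ρmp ρpp ρmm ρpm : ℝ)
    (hmp : 0 < ρmp) (hpp : 0 < ρpp) (hmm : 0 < ρmm) (hpm : 0 < ρpm)
    (hdmp : ρmp ^ γ = max 0 (ρi ^ γ + (ρi + ρip) / 2 * (min φi φip - φi)))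
    (hdpp : ρpp ^ γ = max 0 (ρip ^ γ + (ρi + ρip) / 2 * (min φi φip - φip)))
    (hdmm : ρmm ^ γ = max 0 (ρim ^ γ + (ρim + ρi) / 2 * (min φim φi - φim)))
    (hdpm : ρpm ^ γ = max 0 (ρi ^ γ + (ρim + ρi) / 2 * (min φim φi - φi))) :
    Tendsto (fun ε : ℝ =>
        ρi - (ε ^ 2 * Δt / (ε ^ 2 + Δt)) *
            ((rusanovFlux γ ε (ρmp, ρmp * (qi / ρi)) (ρpp, ρpp * (qip / ρip))).1
              - (rusanovFlux γ ε (ρmm, ρmm * (qim / ρim)) (ρpm, ρpm * (qi / ρi))).1) / Δx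
          + (ε ^ 2 * Δt ^ 2 / (ε ^ 2 + Δt)) *
              (qip ^ 2 / ρip - 2 * qi ^ 2 / ρi + qim ^ 2 / ρim) / Δx ^ 2
          + (Δt ^ 2 / (ε ^ 2 + Δt)) * (ρip ^ γ - 2 * ρi ^ γ + ρim ^ γ) / Δx ^ 2
          - (Δt ^ 2 / (ε ^ 2 + Δt)) *
              ((ρi + ρip) / 2 * (φip - φi) - (ρim + ρi) / 2 * (φi - φim)) / Δx ^ 2)
      (nhdsWithin 0 (Set.Ioi 0))
      (nhds (ρi + Δt * (ρip ^ γ - 2 * ρi ^ γ + ρim ^ γ) / Δx ^ 2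
        - Δt * ((ρi + ρip) / 2 * (φip - φi) - (ρim + ρi) / 2 * (φi - φim)) / Δx ^ 2)) := by
  have hid : Tendsto (fun ε : ℝ => ε) (𝓝[>] 0) (𝓝 0) := nhdsWithin_le_nhds
  have hsq : Tendsto (fun ε : ℝ => ε ^ 2) (𝓝[>] 0) (𝓝 0) := by simpa using hid.pow 2
  have hden : Tendsto (fun ε : ℝ => (ε ^ 2 + Δt)⁻¹) (𝓝[>] 0) (𝓝 Δt⁻¹) := by
    simpa using (hsq.add_const Δt).inv₀ (by simpa using hΔt.ne')
  have hflux := (tendsto_sq_mul_rusanovFlux_fst γ (ρmp, ρmp * (qi / ρi))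
    (ρpp, ρpp * (qip / ρip))).sub (tendsto_sq_mul_rusanovFlux_fst γ (ρmm, ρmm * (qim / ρim))
    (ρpm, ρpm * (qi / ρi)))
  have h1 := (hden.mul hflux).mul_const (Δt / Δx)
  have h2 := (hden.mul hsq).mul_const
    (Δt ^ 2 * (qip ^ 2 / ρip - 2 * qi ^ 2 / ρi + qim ^ 2 / ρim) / Δx ^ 2)
  have h3 := hden.mul_const (Δt ^ 2 * (ρip ^ γ - 2 * ρi ^ γ + ρim ^ γ) / Δx ^ 2)
  have h4 := hden.mul_const
    (Δt ^ 2 * ((ρi + ρip) / 2 * (φip - φi) - (ρim + ρi) / 2 * (φi - φim)) / Δx ^ 2)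
  convert (((h1.const_sub ρi).add h2).add h3).sub h4 using 1
  · ext ε
    ring
  · congr 1
    field_simp
    ring
end
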